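/- For a finite Coxeter group with Δ, I ⊆ Δ, i ∉ I, the element w = ℓ_I ℓ_{I+i} satisfies ℓ_{ω_i(I)} ℓ_{I+i} ℓ_I ℓ_{I+i} = 1, where ω_i(I) = (I ∪ {i}) \ {ι_{I+i}(i)}; in other words w⁻¹ = ℓ_{ω_i(I)} ℓ_{I+i}. -/

import Mathlib

namespace CoxeterSystem

open Module Polynomial.Chebyshev

variable {B W : Type*} [Group W] {M : CoxeterMatrix B} (cs : CoxeterSystem M W)

/-! ### The geometric representation -/

section Geometric

theorem reflection_mul_reflection_pow_eq_one_of_cos {V : Type*} [AddCommGroup V] [Module ℝ V]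
    {x y : V} {f g : Dual ℝ V} (hf : f x = 2) (hg : g y = 2) {m : ℕ} (hm : 2 ≤ m)
    (hfy : f y = -2 * Real.cos (Real.pi / m)) (hgx : g x = -2 * Real.cos (Real.pi / m)) :
    (reflection hf * reflection hg) ^ m = 1 := by
  obtain rfl | hm3 : m = 2 ∨ 3 ≤ m := by omega
  · simp only [Nat.cast_ofNat, Real.cos_pi_div_two, mul_zero] at hfy hgx
    ext z
    simp only [pow_two, LinearEquiv.mul_apply, reflection_apply, map_sub, map_smul, hf, hg, hfy,
      hgx, LinearEquiv.coe_one, id]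
    module
  · have hm0 : (0 : ℝ) < m := by positivity
    set θ : ℝ := 2 * Real.pi / m with hθ
    have ht : 2 * Real.cos θ = f y * g x - 2 := by
      rw [hfy, hgx, hθ, mul_div_assoc, Real.cos_two_mul]
      ring
    have hsin : Real.sin θ ≠ 0 := by
      refine (Real.sin_pos_of_pos_of_lt_pi (by positivity) ?_).ne'
      have : (3 : ℝ) ≤ m := by exact_mod_cast hm3
      rw [hθ, div_lt_iff₀ hm0]
      nlinarith [Real.pi_pos]
    ext z
    rw [reflection_mul_reflection_pow_apply hf hg m z (2 * Real.cos θ) ht]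
    obtain ⟨k, rfl | rfl⟩ := Nat.even_or_odd' m
    · have hS : (S ℝ ((k : ℤ) - 1)).eval (2 * Real.cos θ) = 0 := by
        apply mul_right_cancel₀ hsin
        rw [S_two_mul_real_cos, zero_mul]
        convert Real.sin_pi using 2
        rw [hθ]
        push_cast at hm0 ⊢
        have : (k : ℝ) ≠ 0 := by rintro h; simp [h] at hm0
        field_simp
        ring
      have e1 : ((2 * k : ℕ) - 2 : ℤ) / 2 = k - 1 := by push_cast; omega
      have e2 : ((2 * k : ℕ) - 1 : ℤ) / 2 = k - 1 := by push_cast; omega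
      rw [e1, e2, hS]
      simp
    · have hS : (S ℝ (k : ℤ)).eval (2 * Real.cos θ) + (S ℝ ((k : ℤ) - 1)).eval (2 * Real.cos θ)
          = 0 := by
        apply mul_right_cancel₀ hsin
        rw [add_mul, S_two_mul_real_cos, S_two_mul_real_cos, zero_mul, Int.cast_sub, Int.cast_one,
          sub_add_cancel, Int.cast_natCast]
        have : ((k : ℝ) + 1) * θ = 2 * Real.pi - k * θ := by
          rw [hθ]
          push_cast at hm0 ⊢
          field_simp
          ring
        rw [this, Real.sin_two_pi_sub, neg_add_cancel]
      have e1 : ((2 * k + 1 : ℕ) - 2 : ℤ) / 2 = k - 1 := by push_cast; omega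
      have e2 : ((2 * k + 1 : ℕ) - 1 : ℤ) / 2 = k := by push_cast; omega
      have e3 : ((2 * k + 1 : ℕ) - 3 : ℤ) / 2 = k - 1 := by push_cast; omega
      have e4 : ((2 * k + 1 : ℕ) : ℤ) / 2 = k := by push_cast; omega
      rw [e1, e2, e3, e4, hS]
      simp

/-- The linear form on `B →₀ ℝ` given by twice the standard bilinear form of `M` against the
simple root at `i`. -/
noncomputable def _root_.CoxeterMatrix.simpleCoroot (M : CoxeterMatrix B) (i : B) :
    Dual ℝ (B →₀ ℝ) :=
  Finsupp.linearCombination ℝ fun j ↦ -2 * Real.cos (Real.pi / M i j)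

theorem _root_.CoxeterMatrix.simpleCoroot_single (M : CoxeterMatrix B) (i j : B) :
    M.simpleCoroot i (Finsupp.single j 1) = -2 * Real.cos (Real.pi / M i j) := by
  simp [CoxeterMatrix.simpleCoroot]

theorem _root_.CoxeterMatrix.simpleCoroot_single_self (M : CoxeterMatrix B) (i : B) :
    M.simpleCoroot i (Finsupp.single i 1) = 2 := by
  simp [CoxeterMatrix.simpleCoroot_single]

theorem _root_.CoxeterMatrix.isLiftable_reflection (M : CoxeterMatrix B) :
    M.IsLiftable fun i ↦ reflection (M.simpleCoroot_single_self i) := by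
  intro i j
  rcases eq_or_ne i j with rfl | hij
  · rw [M.diagonal, pow_one]
    refine LinearEquiv.ext fun z ↦ ?_
    rw [LinearEquiv.mul_apply]
    exact involutive_reflection (M.simpleCoroot_single_self i) z
  · have h1 := M.off_diagonal i j hij
    obtain h0 | h2 : M i j = 0 ∨ 2 ≤ M i j := by omega
    · rw [h0, pow_zero]
    · refine reflection_mul_reflection_pow_eq_one_of_cos _ _ h2 (M.simpleCoroot_single i j) ?_
      rw [M.simpleCoroot_single, M.symmetric]

/-- The geometric representation of a Coxeter group. -/
noncomputable def geometricRep : W →* ((B →₀ ℝ) ≃ₗ[ℝ] (B →₀ ℝ)) :=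
  cs.lift ⟨_, M.isLiftable_reflection⟩

theorem geometricRep_simple_apply (i : B) (v : B →₀ ℝ) :
    cs.geometricRep (cs.simple i) v = v - M.simpleCoroot i v • Finsupp.single i 1 := by
  rw [geometricRep, lift_apply_simple, reflection_apply]

/-- A standard parabolic subgroup contains no simple reflections other than its generators. -/
theorem simple_mem_closure_iff {J : Set B} {k : B} :
    cs.simple k ∈ Subgroup.closure (cs.simple '' J) ↔ k ∈ J := by
  refine ⟨fun hk ↦ ?_, fun hk ↦ Subgroup.subset_closure ⟨k, hk, rfl⟩⟩
  by_contra hkJ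
  have key : ∀ w ∈ Subgroup.closure (cs.simple '' J), ∀ v, cs.geometricRep w v k = v k := by
    intro w hw
    induction hw using Subgroup.closure_induction with
    | mem x hx =>
      obtain ⟨j, hj, rfl⟩ := hx
      have hjk : j ≠ k := fun h ↦ hkJ (h ▸ hj)
      intro v
      simp [geometricRep_simple_apply, hjk]
    | one => simp
    | mul x y _ _ hx hy =>
      intro v
      rw [map_mul, LinearEquiv.mul_apply, hx, hy]
    | inv x _ hx =>
      intro v
      rw [← hx, ← LinearEquiv.mul_apply, ← map_mul, mul_inv_cancel, map_one]
      rfl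
  have h := key _ hk (Finsupp.single k 1)
  rw [geometricRep_simple_apply, M.simpleCoroot_single_self] at h
  norm_num at h

theorem simple_injective : Function.Injective cs.simple := by
  intro i j h
  rw [← Set.mem_singleton_iff, ← cs.simple_mem_closure_iff]
  exact Subgroup.subset_closure ⟨j, rfl, h.symm⟩

end Geometric

/-! ### The parity of inversions -/

section InversionParity

theorem end_mul_apply {α : Type*} (f g : Function.End α) (x : α) : (f * g) x = f (g x) := rfl

open Classical in
/-- The action of a simple reflection on pairs of an element and a sign, conjugating the element
and switching the sign exactly when the element is the reflection itself. -/
noncomputable def signedConj (i : B) : Function.End (W × ZMod 2) := fun p ↦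
  (cs.simple i * p.1 * (cs.simple i)⁻¹, p.2 + if p.1 = cs.simple i then 1 else 0)

open Classical in
theorem signedConj_mul_pow_apply (i j : B) (m : ℕ) (p : W × ZMod 2) :
    ((cs.signedConj i * cs.signedConj j) ^ m) p =
      ((cs.simple i * cs.simple j) ^ m * p.1 * ((cs.simple i * cs.simple j) ^ m)⁻¹,
        p.2 + ∑ k ∈ Finset.range (2 * m),
          if p.1 = cs.simple j * (cs.simple i * cs.simple j) ^ k then 1 else 0) := by
  induction m with
  | zero => simp [Function.End.one_def]
  | succ m ih =>
    set r := cs.simple i * cs.simple j with hr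
    have hinv : ∀ k : ℕ, cs.simple j * r ^ k = (r ^ k)⁻¹ * cs.simple j := by
      intro k
      rw [← inv_pow]
      have : SemiconjBy (cs.simple j) r r⁻¹ := by
        simp [SemiconjBy, hr, mul_assoc]
      exact this.pow_right k
    have h1 : r ^ m * p.1 * (r ^ m)⁻¹ = cs.simple j ↔ p.1 = cs.simple j * r ^ (2 * m) := by
      rw [two_mul, pow_add, ← mul_assoc, hinv m, mul_inv_eq_iff_eq_mul, mul_assoc,
        eq_inv_mul_iff_mul_eq]
    have h2 : cs.simple j * (r ^ m * p.1 * (r ^ m)⁻¹) * (cs.simple j)⁻¹ = cs.simple i ↔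
        p.1 = cs.simple j * r ^ (2 * m + 1) := by
      rw [show 2 * m + 1 = m + (1 + m) by ring, pow_add, pow_add, ← mul_assoc (cs.simple j) (r ^ m),
        hinv m, pow_one, mul_inv_eq_iff_eq_mul, ← hr, ← eq_inv_mul_iff_mul_eq,
        mul_inv_eq_iff_eq_mul, inv_simple, ← eq_inv_mul_iff_mul_eq]
      simp only [mul_assoc]
    rw [pow_succ', end_mul_apply, ih, mul_add, mul_one,
      Finset.sum_range_succ, Finset.sum_range_succ]
    simp only [end_mul_apply, signedConj, h1, h2, pow_succ' r m]
    refine Prod.ext ?_ ?_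
    · simp [hr, mul_assoc]
    · simp [add_assoc]

theorem isLiftable_signedConj : M.IsLiftable cs.signedConj := by
  classical
  intro i j
  funext p
  rw [signedConj_mul_pow_apply, two_mul, Finset.sum_range_add]
  simp [pow_add, CharTwo.add_self_eq_zero, Function.End.one_def]

/-- The signed conjugation action of a Coxeter group on pairs of an element and a sign. -/
noncomputable def signedConjHom : W →* Function.End (W × ZMod 2) :=
  cs.lift ⟨_, cs.isLiftable_signedConj⟩

/-- The parity of the number of occurrences of `t` in the right inversion sequence of any word
for `w`. -/
noncomputable def inversionParity (w t : W) : ZMod 2 := (cs.signedConjHom w (t, 0)).2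

theorem signedConjHom_apply (w : W) (p : W × ZMod 2) :
    cs.signedConjHom w p = (w * p.1 * w⁻¹, p.2 + cs.inversionParity w p.1) := by
  induction w using cs.simple_induction_left generalizing p with
  | one => simp [inversionParity, Function.End.one_def]
  | mul_simple_left w i ih =>
    have h : ∀ q, cs.signedConjHom (cs.simple i * w) q =
        cs.signedConj i (cs.signedConjHom w q) := by
      intro q
      rw [map_mul, end_mul_apply, signedConjHom, lift_apply_simple]
    rw [inversionParity, h, h, ih, ih]
    simp [signedConj, mul_assoc, add_assoc]

@[simp]
theorem inversionParity_one (t : W) : cs.inversionParity 1 t = 0 := by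
  simp [inversionParity, Function.End.one_def]

theorem inversionParity_mul (u v t : W) :
    cs.inversionParity (u * v) t =
      cs.inversionParity v t + cs.inversionParity u (v * t * v⁻¹) := by
  rw [inversionParity, map_mul, end_mul_apply, signedConjHom_apply,
    signedConjHom_apply, zero_add]

open Classical in
theorem inversionParity_simple (i : B) (t : W) :
    cs.inversionParity (cs.simple i) t = if t = cs.simple i then 1 else 0 := by
  rw [inversionParity, signedConjHom, lift_apply_simple]
  simp [signedConj]

theorem inversionParity_inv (w t : W) :
    cs.inversionParity w⁻¹ t = cs.inversionParity w (w⁻¹ * t * w) := by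
  have h := cs.inversionParity_mul w w⁻¹ t
  rw [mul_inv_cancel, inversionParity_one, inv_inv] at h
  exact CharTwo.add_eq_zero.1 h.symm

open Classical in
theorem inversionParity_wordProd (ω : List B) (t : W) :
    cs.inversionParity (cs.wordProd ω) t = ((cs.rightInvSeq ω).count t : ZMod 2) := by
  induction ω with
  | nil => simp
  | cons i ω ih =>
    rw [wordProd_cons, inversionParity_mul, ih, inversionParity_simple, rightInvSeq,
      List.count_cons]
    have : cs.wordProd ω * t * (cs.wordProd ω)⁻¹ = cs.simple i ↔
        (cs.wordProd ω)⁻¹ * cs.simple i * cs.wordProd ω = t := by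
      rw [mul_inv_eq_iff_eq_mul, mul_assoc, inv_mul_eq_iff_eq_mul, eq_comm]
    simp [this]

theorem isRightInversion_of_inversionParity_ne_zero {w t : W} (h : cs.inversionParity w t ≠ 0) :
    cs.IsRightInversion w t := by
  classical
  obtain ⟨ω, hω, rfl⟩ := cs.exists_isReduced w
  rw [inversionParity_wordProd] at h
  refine cs.isRightInversion_of_mem_rightInvSeq hω (List.count_pos_iff.1 (Nat.pos_of_ne_zero ?_))
  rintro h0
  simp [h0] at h

theorem IsReflection.inversionParity_self {t : W} (ht : cs.IsReflection t) :
    cs.inversionParity t t = 1 := by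
  obtain ⟨u, i, rfl⟩ := ht
  rw [inversionParity_mul, inversionParity_mul, inversionParity_inv]
  simp only [mul_assoc, inv_mul_cancel_left, inv_mul_cancel, mul_one, one_mul, inv_inv, inv_simple,
    simple_mul_simple_self, inversionParity_simple, if_true]
  rw [add_left_comm, CharTwo.add_self_eq_zero, add_zero]

/-- The strong exchange property, stated through the parity of inversions. -/
theorem inversionParity_ne_zero_iff {w t : W} :
    cs.inversionParity w t ≠ 0 ↔ cs.IsRightInversion w t := by
  refine ⟨cs.isRightInversion_of_inversionParity_ne_zero, fun ⟨ht, hlt⟩ h0 ↦ ?_⟩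
  have h : cs.inversionParity (w * t) t ≠ 0 := by
    rw [inversionParity_mul, mul_inv_cancel_right, h0, ht.inversionParity_self]
    decide
  have := (cs.isRightInversion_of_inversionParity_ne_zero h).2
  rw [mul_assoc, ht.mul_self, mul_one] at this
  exact absurd hlt this.not_gt

theorem eq_one_of_inversionParity_eq_zero {w : W} (h : ∀ t, cs.inversionParity w t = 0) :
    w = 1 := by
  by_contra hw
  obtain ⟨i, hi⟩ := cs.exists_rightDescent_of_ne_one hw
  exact cs.inversionParity_ne_zero_iff.2 ((cs.isRightInversion_simple_iff_isRightDescent w i).2 hi)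
    (h _)

theorem inversionParity_injective : Function.Injective cs.inversionParity := by
  intro u v h
  refine mul_inv_eq_one.1 (cs.eq_one_of_inversionParity_eq_zero fun t ↦ ?_)
  rw [inversionParity_mul, h, ← inversionParity_mul, mul_inv_cancel, inversionParity_one]

theorem mem_closure_of_inversionParity_ne_zero {J : Set B} {w : W}
    (hw : w ∈ Subgroup.closure (cs.simple '' J)) {t : W} (h : cs.inversionParity w t ≠ 0) :
    t ∈ Subgroup.closure (cs.simple '' J) := by
  induction hw using Subgroup.closure_induction generalizing t with
  | mem x hx =>
    obtain ⟨j, hj, rfl⟩ := hx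
    rw [inversionParity_simple] at h
    rw [show t = cs.simple j by by_contra ht; simp [ht] at h]
    exact Subgroup.subset_closure ⟨j, hj, rfl⟩
  | one => simp at h
  | mul x y hx hy ihx ihy =>
    rw [inversionParity_mul] at h
    by_cases hyt : cs.inversionParity y t = 0
    · rw [hyt, zero_add] at h
      have := ihx h
      rwa [Subgroup.mul_mem_cancel_right _ (inv_mem hy), Subgroup.mul_mem_cancel_left _ hy] at this
    · exact ihy hyt
  | inv x hx ih =>
    rw [inversionParity_inv] at h
    have := ih h
    rwa [Subgroup.mul_mem_cancel_right _ hx, Subgroup.mul_mem_cancel_left _ (inv_mem hx)] at this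

end InversionParity

/-! ### Longest elements of standard parabolic subgroups -/

/-- `w` is an element of maximal length in the standard parabolic subgroup of `J`. -/
def IsLongestIn (J : Set B) (w : W) : Prop :=
  w ∈ Subgroup.closure (cs.simple '' J) ∧
    ∀ v ∈ Subgroup.closure (cs.simple '' J), cs.length v ≤ cs.length w

variable {cs} {J : Set B} {u v w : W}

theorem IsLongestIn.inversionParity_ne_zero_iff (hw : cs.IsLongestIn J w) {t : W} :
    cs.inversionParity w t ≠ 0 ↔
      cs.IsReflection t ∧ t ∈ Subgroup.closure (cs.simple '' J) := by
  refine ⟨fun h ↦ ⟨(cs.isRightInversion_of_inversionParity_ne_zero h).1,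
    cs.mem_closure_of_inversionParity_ne_zero hw.1 h⟩, fun ⟨ht, htJ⟩ ↦ ?_⟩
  exact cs.inversionParity_ne_zero_iff.2
    ⟨ht, lt_of_le_of_ne (hw.2 _ (mul_mem hw.1 htJ)) (ht.length_mul_left_ne w)⟩

theorem eq_of_inversionParity_ne_zero_iff
    (h : ∀ t, cs.inversionParity u t ≠ 0 ↔ cs.inversionParity v t ≠ 0) : u = v := by
  have aux : ∀ a b : ZMod 2, (a ≠ 0 ↔ b ≠ 0) → a = b := by decide
  exact cs.inversionParity_injective (funext fun t ↦ aux _ _ (h t))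

theorem IsLongestIn.eq (hu : cs.IsLongestIn J u) (hv : cs.IsLongestIn J v) : u = v :=
  eq_of_inversionParity_ne_zero_iff fun _ ↦ by
    rw [hu.inversionParity_ne_zero_iff, hv.inversionParity_ne_zero_iff]

theorem IsLongestIn.inv (hw : cs.IsLongestIn J w) : cs.IsLongestIn J w⁻¹ :=
  ⟨inv_mem hw.1, fun v hv ↦ (cs.length_inv w).symm ▸ hw.2 v hv⟩

theorem IsLongestIn.inv_eq (hw : cs.IsLongestIn J w) : w⁻¹ = w := hw.inv.eq hw

theorem IsLongestIn.inversionParity_conj (hw : cs.IsLongestIn J w)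
    (hu : u ∈ Subgroup.closure (cs.simple '' J)) (t : W) :
    cs.inversionParity w (u * t * u⁻¹) = cs.inversionParity w t := by
  have aux : ∀ a b : ZMod 2, (a ≠ 0 ↔ b ≠ 0) → a = b := by decide
  apply aux
  rw [hw.inversionParity_ne_zero_iff, hw.inversionParity_ne_zero_iff, cs.isReflection_conj_iff,
    Subgroup.mul_mem_cancel_right _ (inv_mem hu), Subgroup.mul_mem_cancel_left _ hu]

/-- If conjugation by the longest element `w` of a parabolic subgroup carries a smaller standard
parabolic subgroup to another one, then it carries longest element to longest element. -/
theorem IsLongestIn.conj_eq {I K : Set B} (hw : cs.IsLongestIn J w) (hu : cs.IsLongestIn I u)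
    (hv : cs.IsLongestIn K v) (hIJ : I ⊆ J)
    (hIK : ∀ t, w * t * w⁻¹ ∈ Subgroup.closure (cs.simple '' I) ↔
      t ∈ Subgroup.closure (cs.simple '' K)) :
    w * u * w = v := by
  have huJ := Subgroup.closure_mono (Set.image_mono hIJ) hu.1
  refine eq_of_inversionParity_ne_zero_iff (cs := cs) fun t ↦ ?_
  rw [mul_assoc, inversionParity_mul, hw.inversionParity_conj (mul_mem huJ hw.1),
    inversionParity_mul, add_right_comm, CharTwo.add_self_eq_zero, zero_add,
    hu.inversionParity_ne_zero_iff, hv.inversionParity_ne_zero_iff, cs.isReflection_conj_iff, hIK]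

/-- Conjugation by the longest element of the parabolic subgroup of `J` carries the maximal
parabolic subgroup of `J \ {i}` to that of `J \ {ι i}`, where `ι` is the Dynkin involution. -/
theorem IsLongestIn.conj_mem_closure_iff (hw : cs.IsLongestIn J w) {i : B} (hi : i ∈ J) {ι : B → B}
    (hι : ∀ j ∈ J, w * cs.simple j * w⁻¹ = cs.simple (ι j)) (t : W) :
    w * t * w⁻¹ ∈ Subgroup.closure (cs.simple '' (J \ {i})) ↔
      t ∈ Subgroup.closure (cs.simple '' (J \ {ι i})) := by
  have hww : w * w = 1 := mul_eq_one_iff_inv_eq.2 hw.inv_eq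
  have hιJ : ∀ j ∈ J, ι j ∈ J := fun j hj ↦ by
    rw [← cs.simple_mem_closure_iff, ← hι j hj]
    exact mul_mem (mul_mem hw.1 (cs.simple_mem_closure_iff.2 hj)) (inv_mem hw.1)
  have hιι : ∀ j ∈ J, ι (ι j) = j := fun j hj ↦ by
    apply cs.simple_injective
    rw [← hι _ (hιJ j hj), ← hι j hj, hw.inv_eq]
    simp [mul_assoc, hww, ← mul_assoc w w]
  have conj : ∀ k ∈ J, ∀ g ∈ Subgroup.closure (cs.simple '' (J \ {k})),
      w * g * w⁻¹ ∈ Subgroup.closure (cs.simple '' (J \ {ι k})) := by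
    intro k hk g hg
    have : Subgroup.closure (cs.simple '' (J \ {k})) ≤
        (Subgroup.closure (cs.simple '' (J \ {ι k}))).comap (MulAut.conj w).toMonoidHom := by
      rw [Subgroup.closure_le]
      rintro _ ⟨j, ⟨hj, hjk⟩, rfl⟩
      refine Subgroup.subset_closure ⟨ι j, ⟨hιJ j hj, fun h ↦ hjk ?_⟩, (hι j hj).symm⟩
      rw [Set.mem_singleton_iff] at h ⊢
      rw [← hιι j hj, h, hιι k hk]
    exact this hg
  refine ⟨fun h ↦ ?_, fun h ↦ ?_⟩
  · have := conj i hi _ h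
    rw [hw.inv_eq] at this
    simpa [mul_assoc, hww, ← mul_assoc w w] using this
  · simpa [hιι i hi] using conj (ι i) (hιJ i hi) t h

end CoxeterSystem

/-!
STATEMENT 7: For a finite Coxeter group with simple generators indexed by `Δ`, `I ⊆ Δ`,
`i ∉ I`, the element `w = ℓ_I ℓ_{I+i}` satisfies
`ℓ_{ω_i(I)} ℓ_{I+i} ℓ_I ℓ_{I+i} = 1`, where `ω_i(I) = (I ∪ {i}) \ {ι_{I+i}(i)}`;
in other words `w⁻¹ = ℓ_{ω_i(I)} ℓ_{I+i}`.

Here `ℓ_Γ` denotes the longest element of the standard parabolic subgroup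
`W_Γ = ⟨sⱼ : j ∈ Γ⟩` (characterised as an element of maximal Coxeter length), and
`ι_{I+i}` is the Dynkin involution of `I ∪ {i}`, determined by conjugation:
`ℓ_{I+i} sⱼ ℓ_{I+i}⁻¹ = s_{ι_{I+i}(j)}` for `j ∈ I ∪ {i}`.
-/
theorem stmt7 {Δ W : Type*} [Group W] [Finite W] {M : CoxeterMatrix Δ}
    (cs : CoxeterSystem M W)
    (I : Set Δ) (i : Δ) (hi : i ∉ I)
    (ι : Δ → Δ)
    (ℓI ℓIi ℓK : W)
    -- ℓ_I is the longest element of W_I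
    (hℓImem : ℓI ∈ Subgroup.closure (cs.simple '' I))
    (hℓImax : ∀ v ∈ Subgroup.closure (cs.simple '' I), cs.length v ≤ cs.length ℓI)
    -- ℓ_{I+i} is the longest element of W_{I∪{i}}
    (hℓIimem : ℓIi ∈ Subgroup.closure (cs.simple '' (I ∪ {i})))
    (hℓIimax : ∀ v ∈ Subgroup.closure (cs.simple '' (I ∪ {i})), cs.length v ≤ cs.length ℓIi)
    -- the Dynkin involution ι_{I+i}
    (hι : ∀ j ∈ I ∪ {i}, ℓIi * cs.simple j * ℓIi⁻¹ = cs.simple (ι j))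
    -- ℓ_{ω_i(I)} is the longest element of W_{ω_i(I)}, ω_i(I) = (I ∪ {i}) \ {ι_{I+i}(i)}
    (hℓKmem : ℓK ∈ Subgroup.closure (cs.simple '' ((I ∪ {i}) \ {ι i})))
    (hℓKmax : ∀ v ∈ Subgroup.closure (cs.simple '' ((I ∪ {i}) \ {ι i})),
      cs.length v ≤ cs.length ℓK) :
    ℓK * ℓIi * ℓI * ℓIi = 1 ∧ (ℓI * ℓIi)⁻¹ = ℓK * ℓIi := by
  have hJ : cs.IsLongestIn (I ∪ {i}) ℓIi := ⟨hℓIimem, hℓIimax⟩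
  have hI : cs.IsLongestIn I ℓI := ⟨hℓImem, hℓImax⟩
  have hdiff : (I ∪ {i}) \ {i} = I := by simp [hi]
  have hK : ℓIi * ℓI * ℓIi = ℓK := by
    refine hJ.conj_eq hI ⟨hℓKmem, hℓKmax⟩ Set.subset_union_left fun t ↦ ?_
    rw [← hJ.conj_mem_closure_iff (by simp) hι, hdiff]
  have hinv : (ℓI * ℓIi)⁻¹ = ℓK * ℓIi := by
    rw [← hK, mul_inv_rev, hI.inv_eq, hJ.inv_eq]
    nth_rw 4 [← hJ.inv_eq]
    rw [mul_inv_cancel_right]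
  exact ⟨by rw [mul_assoc, ← hinv, inv_mul_cancel], hinv⟩
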